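/- Let $f : \mathbb{R}^n \to \mathbb{R}$ be continuous, let $q : \mathbb{R}^n \times \mathbb{R}^n \to \mathbb{R}_{\geq 0}$ be continuous in its first argument, satisfy $q(x,x) = 0$ for all $x$, and satisfy $\beta_1 \Vert x - y \Vert \leq q(x,y) \leq \beta_2 \Vert x - y \Vert$ for some $\beta_1, \beta_2 > 0$, and let $\Gamma : \mathbb{R}_{\geq 0} \to \mathbb{R}$ be continuous with $\Gamma[0] = 0$. Let $\sigma \in [0,1)$, let $\{\lambda_k\} \subset [\bar\lambda, \tilde\lambda]$ with $0 < \bar\lambda \leq \tilde\lambda < +\infty$ converge to $\lambda_\infty$, and let $\{x^k\} \subset \mathbb{R}^n$ converge to $x^*$. Suppose that for every $k$ and every $y \in \mathbb{R}^n$, $f(y) - f(x^{k+1}) \geq \lambda_k \big[ (1-\sigma) \Gamma[q(x^k,x^{k+1})] - \Gamma[q(x^k,y)] \big]$. Then $f(x^*) \leq f(y) + \lambda_\infty \Gamma[q(x^*,y)]$ for all $y \in \mathbb{R}^n$; that is, $x^*$ is a weak variational trap with rate $\lambda_\infty$. -/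

import Mathlib

open Filter Topology

/-- Passing to the limit in the worthwhile-to-change condition of Algorithm 2:
if `x^k → x^*`, `λ_k → λ_∞` with `λ_k ∈ [λ̄, λ̃]`, and for all `k` and all `y`
`f(y) - f(x^{k+1}) ≥ λ_k[(1-σ)Γ[q(x^k,x^{k+1})] - Γ[q(x^k,y)]]`, then
`f(x^*) ≤ f(y) + λ_∞ Γ[q(x^*,y)]` for all `y`, i.e. `x^*` is a weak variational trap. -/
theorem limit_point_is_weak_variational_trap
    (n : ℕ) (f : EuclideanSpace ℝ (Fin n) → ℝ) (hf : Continuous f)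
    (q : EuclideanSpace ℝ (Fin n) → EuclideanSpace ℝ (Fin n) → ℝ)
    (hq_nonneg : ∀ x y, 0 ≤ q x y) (hq_diag : ∀ x, q x x = 0)
    (hq_cont : ∀ y, Continuous fun x => q x y)
    (β₁ β₂ : ℝ) (hβ₁ : 0 < β₁) (hβ₂ : 0 < β₂)
    (hbound : ∀ x y, β₁ * ‖x - y‖ ≤ q x y ∧ q x y ≤ β₂ * ‖x - y‖)
    (Γ : ℝ → ℝ) (hΓ_cont : Continuous Γ) (hΓ0 : Γ 0 = 0)
    (σ : ℝ) (hσ : σ ∈ Set.Ico (0 : ℝ) 1)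
    (lam : ℕ → ℝ) (lamlb lamub : ℝ) (hlamlb : 0 < lamlb) (hlamord : lamlb ≤ lamub)
    (hlam : ∀ k, lam k ∈ Set.Icc lamlb lamub)
    (laminf : ℝ) (hlaminf : Tendsto lam atTop (𝓝 laminf))
    (x : ℕ → EuclideanSpace ℝ (Fin n)) (xstar : EuclideanSpace ℝ (Fin n))
    (hx : Tendsto x atTop (𝓝 xstar))
    (hstep : ∀ k, ∀ y, f y - f (x (k + 1)) ≥
      lam k * ((1 - σ) * Γ (q (x k) (x (k + 1))) - Γ (q (x k) y))) :
    ∀ y, f xstar ≤ f y + laminf * Γ (q xstar y) := by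
  intro y
  have hx1 : Tendsto (fun k => x (k + 1)) atTop (𝓝 xstar) :=
    hx.comp (tendsto_add_atTop_nat 1)
  have hq0 : Tendsto (fun k => q (x k) (x (k + 1))) atTop (𝓝 0) := by
    have h : Tendsto (fun k => β₂ * ‖x k - x (k + 1)‖) atTop (𝓝 0) := by
      have h2 := ((hx.sub hx1).norm).const_mul β₂
      simpa using h2
    exact squeeze_zero (fun k => hq_nonneg _ _) (fun k => (hbound _ _).2) h
  have hΓ1 : Tendsto (fun k => Γ (q (x k) (x (k + 1)))) atTop (𝓝 0) := by
    have h := (hΓ_cont.tendsto 0).comp hq0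
    rw [hΓ0] at h
    exact h
  have hΓ2 : Tendsto (fun k => Γ (q (x k) y)) atTop (𝓝 (Γ (q xstar y))) :=
    ((hΓ_cont.comp (hq_cont y)).tendsto xstar).comp hx
  have hR := hlaminf.mul ((hΓ1.const_mul (1 - σ)).sub hΓ2)
  have hf1 : Tendsto (fun k => f (x (k + 1))) atTop (𝓝 (f xstar)) :=
    (hf.tendsto xstar).comp hx1
  have hL := (tendsto_const_nhds (x := f y)).sub hf1
  have h := le_of_tendsto_of_tendsto' hR hL (fun k => hstep k y)
  linarith
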